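/- Define Q : F_3^6 → F_3 by Q(v) = v_1·v_2 + v_3·v_4 + v_5^2 + v_6^2 (a quadratic form of minus type on F_3^6 defining the elliptic quadric Q⁻(5, 3)). Let K be the set of points of PG(5, 3) whose representative vectors v satisfy Q(v) = 1 (this condition is independent of the choice of representative, since λ² = 1 for all nonzero λ ∈ F_3). Then K consists of exactly 126 points, and every hyperplane of PG(5, 3) contains exactly 36 or exactly 45 points of K; that is, K is a two-intersection set with parameters (126, 6, 36, 45). -/

import Mathlib

/-- The elliptic quadratic form `v₁v₂ + v₃v₄ + v₅² + v₆²` of minus type on `F₃⁶`. -/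
def ellipticForm (v : Fin 6 → ZMod 3) : ZMod 3 :=
  v 0 * v 1 + v 2 * v 3 + v 4 ^ 2 + v 5 ^ 2

/-- The points of `PG(5,3)` on which the elliptic form takes the value `1`. -/
def ellipticValueOne : Set (Projectivization (ZMod 3) (Fin 6 → ZMod 3)) :=
  {P | ellipticForm P.rep = 1}

/-- Each point of a projective space has as many nonzero representatives as there are units. -/
theorem ncard_nonzero_eq_ncard_projectivization_mul {k V : Type*} [Field k] [AddCommGroup V]
    [Module k V] (p : V → Prop) (hp : ∀ (u : kˣ) (v : V), p (u • v) ↔ p v) :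
    {v : V | v ≠ 0 ∧ p v}.ncard =
      {P : Projectivization k V | p P.rep}.ncard * Nat.card kˣ := by
  have himage : {v : V | v ≠ 0 ∧ p v} =
      (fun x : Projectivization k V × kˣ => x.2 • x.1.rep) ''
        ({P : Projectivization k V | p P.rep} ×ˢ Set.univ) := by
    ext v
    constructor
    · rintro ⟨hv, hpv⟩
      obtain ⟨u, hu⟩ := Projectivization.exists_smul_eq_mk_rep k v hv
      refine ⟨(Projectivization.mk k v hv, u⁻¹), ⟨?_, trivial⟩, ?_⟩
      · change p (Projectivization.mk k v hv).rep
        rw [← hu]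
        exact (hp u v).2 hpv
      · simp [← hu]
    · rintro ⟨⟨P, u⟩, ⟨hP, -⟩, rfl⟩
      exact ⟨(smul_ne_zero_iff_ne u).2 P.rep_nonzero, (hp u _).2 hP⟩
  have hinj : Function.Injective (fun x : Projectivization k V × kˣ => x.2 • x.1.rep) := by
    rintro ⟨P, u⟩ ⟨R, w⟩ h
    have h' : u • P.rep = w • R.rep := h
    have hPR : P = R := by
      rw [← P.mk_rep, ← R.mk_rep, Projectivization.mk_eq_mk_iff]
      exact ⟨u⁻¹ * w, by rw [mul_smul, ← h', inv_smul_smul]⟩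
    subst hPR
    have huw : (u : k) = w := smul_left_injective k P.rep_nonzero h'
    rw [Units.ext huw]
  rw [himage, Set.ncard_image_of_injective _ hinj, Set.ncard_prod, Set.ncard_univ]

/-- The value distribution of a sum of independent variables is a convolution. -/
theorem card_filter_add_eq_sum {A B G : Type*} [Fintype A] [Fintype B] [AddCommGroup G]
    [Fintype G] [DecidableEq G] (f : A → G) (g : B → G) (s : G) :
    (Finset.univ.filter fun x : A × B => f x.1 + g x.2 = s).card =
      ∑ t : G, (Finset.univ.filter fun a => f a = t).card *
        (Finset.univ.filter fun b => g b = s - t).card := by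
  classical
  rw [Finset.card_eq_sum_card_fiberwise (f := fun x : A × B => f x.1) (t := Finset.univ)
    (fun _ _ => Finset.mem_coe.2 (Finset.mem_univ _))]
  refine Finset.sum_congr rfl fun t _ => ?_
  rw [← Finset.card_product]
  congr 1
  ext ⟨a, b⟩
  simp only [Finset.mem_filter, Finset.mem_univ, true_and, Finset.mem_product]
  constructor
  · rintro ⟨h, rfl⟩
    exact ⟨rfl, by rw [← h]; abel⟩
  · rintro ⟨rfl, h⟩
    exact ⟨by rw [h]; abel, rfl⟩

/-- The values of the hyperbolic plane `xy` and of the functional `ax + by`. -/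
def hyperbolicValues (a b : ZMod 3) (x : ZMod 3 × ZMod 3) : ZMod 3 × ZMod 3 :=
  (x.1 * x.2, a * x.1 + b * x.2)

/-- The values of the anisotropic plane `x² + y²` and of the functional `ax + by`. -/
def anisotropicValues (a b : ZMod 3) (x : ZMod 3 × ZMod 3) : ZMod 3 × ZMod 3 :=
  (x.1 ^ 2 + x.2 ^ 2, a * x.1 + b * x.2)

/-- The number of vectors of the plane at which `f` takes the value `s`. -/
def fiberCard (f : ZMod 3 × ZMod 3 → ZMod 3 × ZMod 3) (s : ZMod 3 × ZMod 3) : ℕ :=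
  (Finset.univ.filter fun x => f x = s).card

/-- The number of `v` with `ellipticForm v = 1` in the kernel of the functional with
coefficients `c`. -/
def kernelValueOneCard (c : Fin 6 → ZMod 3) : ℕ :=
  (Finset.univ.filter fun v : Fin 6 → ZMod 3 => ellipticForm v = 1 ∧ ∑ i, c i * v i = 0).card

theorem kernelValueOneCard_eq_sum (c : Fin 6 → ZMod 3) :
    kernelValueOneCard c = ∑ t, fiberCard (hyperbolicValues (c 0) (c 1)) t *
      ∑ u, fiberCard (hyperbolicValues (c 2) (c 3)) u *
        fiberCard (anisotropicValues (c 4) (c 5)) ((1, 0) - t - u) := by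
  simp only [fiberCard, ← card_filter_add_eq_sum]
  refine Finset.card_nbij' (fun v => ((v 0, v 1), (v 2, v 3), (v 4, v 5)))
    (fun x => ![x.1.1, x.1.2, x.2.1.1, x.2.1.2, x.2.2.1, x.2.2.2]) ?_ ?_ ?_ ?_
  · intro v
    simp [hyperbolicValues, anisotropicValues, ellipticForm, Fin.sum_univ_succ, add_assoc]
  · rintro ⟨⟨_, _⟩, ⟨_, _⟩, _, _⟩
    simp [hyperbolicValues, anisotropicValues, ellipticForm, Fin.sum_univ_succ, add_assoc]
  · intro v _
    ext i
    fin_cases i <;> rfl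
  · rintro ⟨⟨_, _⟩, ⟨_, _⟩, _, _⟩ _
    rfl

/-- Up to isometry and scaling, a functional on the hyperbolic plane is one of four. -/
theorem fiberCard_hyperbolicValues (a b : ZMod 3) :
    (a = 0 ∧ b = 0) ∨
      fiberCard (hyperbolicValues a b) = fiberCard (hyperbolicValues 1 (a * b)) := by
  have h : ∀ a b : ZMod 3, (a = 0 ∧ b = 0) ∨
      ∀ s, fiberCard (hyperbolicValues a b) s = fiberCard (hyperbolicValues 1 (a * b)) s := by
    decide +kernel
  exact (h a b).imp_right funext

/-- Up to isometry and scaling, a functional on the anisotropic plane is one of three. -/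
theorem fiberCard_anisotropicValues (a b : ZMod 3) :
    (a = 0 ∧ b = 0) ∨ fiberCard (anisotropicValues a b) = fiberCard (anisotropicValues 1 0) ∨
      fiberCard (anisotropicValues a b) = fiberCard (anisotropicValues 1 1) := by
  have h : ∀ a b : ZMod 3, (a = 0 ∧ b = 0) ∨
      (∀ s, fiberCard (anisotropicValues a b) s = fiberCard (anisotropicValues 1 0) s) ∨
      (∀ s, fiberCard (anisotropicValues a b) s = fiberCard (anisotropicValues 1 1) s) := by
    decide +kernel
  exact (h a b).imp_right (Or.imp funext funext)

theorem kernelValueOneCard_zero : kernelValueOneCard 0 = 252 := by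
  rw [kernelValueOneCard_eq_sum]
  decide +kernel

theorem kernelValueOneCard_of_ne_zero {c : Fin 6 → ZMod 3} (hc : c ≠ 0) :
    kernelValueOneCard c = 72 ∨ kernelValueOneCard c = 90 := by
  have hc' : ¬((c 0 = 0 ∧ c 1 = 0) ∧ (c 2 = 0 ∧ c 3 = 0) ∧ c 4 = 0 ∧ c 5 = 0) := by
    rintro ⟨⟨h0, h1⟩, ⟨h2, h3⟩, h4, h5⟩
    apply hc
    ext i
    fin_cases i <;> simp [*]
  rw [kernelValueOneCard_eq_sum]
  generalize c 0 = c₀, c 1 = c₁, c 2 = c₂, c 3 = c₃, c 4 = c₄, c 5 = c₅ at hc' ⊢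
  rcases fiberCard_hyperbolicValues c₀ c₁ with ⟨rfl, rfl⟩ | h₁ <;>
  rcases fiberCard_hyperbolicValues c₂ c₃ with ⟨rfl, rfl⟩ | h₂ <;>
  rcases fiberCard_anisotropicValues c₄ c₅ with ⟨rfl, rfl⟩ | h₃ | h₃ <;>
  first
  | exact absurd ⟨⟨rfl, rfl⟩, ⟨rfl, rfl⟩, rfl, rfl⟩ hc'
  | simp only [*]
    clear * -
    try generalize c₀ * c₁ = d
    try generalize c₂ * c₃ = e
    decide +revert +kernel

theorem ellipticForm_units_smul (u : (ZMod 3)ˣ) (v : Fin 6 → ZMod 3) :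
    ellipticForm (u • v) = ellipticForm v := by
  have hu : (u : ZMod 3) ^ 2 = 1 := by
    have h : ∀ u : (ZMod 3)ˣ, (u : ZMod 3) ^ 2 = 1 := by decide
    exact h u
  simp only [ellipticForm, Pi.smul_apply, Units.smul_def, smul_eq_mul]
  linear_combination (v 0 * v 1 + v 2 * v 3 + v 4 ^ 2 + v 5 ^ 2) * hu

theorem ncard_mul_two_eq_kernelValueOneCard (φ : (Fin 6 → ZMod 3) →ₗ[ZMod 3] ZMod 3) :
    {P ∈ ellipticValueOne | φ P.rep = 0}.ncard * 2 =
      kernelValueOneCard fun i => φ (Pi.single i 1) := by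
  have h := ncard_nonzero_eq_ncard_projectivization_mul (k := ZMod 3)
    (fun v : Fin 6 → ZMod 3 => ellipticForm v = 1 ∧ φ v = 0) fun u v => by
      rw [ellipticForm_units_smul, Units.smul_def, map_smul]
      simp
  have hunits : Nat.card (ZMod 3)ˣ = 2 := by
    rw [Nat.card_eq_fintype_card]
    decide
  rw [hunits] at h
  refine h.symm.trans ?_
  rw [kernelValueOneCard, ← Set.ncard_coe_finset]
  congr 1
  ext v
  have hφ : φ v = ∑ i, φ (Pi.single i 1) * v i := by
    rw [LinearMap.pi_apply_eq_sum_univ φ v]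
    refine Finset.sum_congr rfl fun i _ => ?_
    rw [smul_eq_mul, mul_comm]
    congr 2
    ext j
    simp [Pi.single_apply, eq_comm]
  simp only [Set.mem_ofPred_eq, Finset.coe_filter, Finset.mem_univ, true_and, ← hφ]
  refine and_iff_right_of_imp ?_
  rintro ⟨hv, -⟩ rfl
  simp [ellipticForm] at hv

theorem elliptic_value_one_two_intersection :
    ellipticValueOne.ncard = 126 ∧
    (∀ φ : (Fin 6 → ZMod 3) →ₗ[ZMod 3] ZMod 3, φ ≠ 0 →
      {P ∈ ellipticValueOne | φ P.rep = 0}.ncard = 36 ∨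
      {P ∈ ellipticValueOne | φ P.rep = 0}.ncard = 45) := by
  constructor
  · have h := ncard_mul_two_eq_kernelValueOneCard 0
    have h0 := kernelValueOneCard_zero
    simp only [LinearMap.zero_apply, and_true, Set.ofPred_mem_eq] at h
    change _ = kernelValueOneCard 0 at h
    omega
  · intro φ hφ
    have h := ncard_mul_two_eq_kernelValueOneCard φ
    have hc : (fun i => φ (Pi.single i 1)) ≠ 0 := by
      intro h0
      apply hφ
      ext i
      simpa using congrFun h0 i
    have := kernelValueOneCard_of_ne_zero hc
    omega
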